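/- Let Γ be the theory over the signature with Herbrand constants C = {a,b} and unary predicate p consisting of the fact p(b) and the rule count{X : p(X)} ≥ 1 → p(a). Then Γ has no stable model under the SQHT=_S equilibrium semantics (with coherence w.r.t. aggregates). -/

import Mathlib

open Classical

noncomputable section

/-! ## Worlds (here and there) -/

inductive W : Type
  | h
  | t

/-- The ordering `h ≤ t` on worlds. -/
def W.le : W → W → Prop
  | .h, _ => True
  | .t, .t => True
  | .t, .h => False

/-! ## Tuples: nonempty finite tuples, encoded as head + tail -/

abbrev Tup (α : Type u) : Type u := α × List α

/-- The tuple `(g 0, …, g n)` determined by a family on `Fin (n+1)`. -/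
def famToTup {α : Type u} {n : ℕ} (g : Fin (n + 1) → α) : Tup α :=
  (g 0, List.ofFn fun i : Fin n => g i.succ)

/-- Combine a finite family of optional values into an optional family:
`some` iff all components are defined. -/
def optFam {α : Type u} {m : ℕ} (f : Fin m → Option α) : Option (Fin m → α) :=
  if h : ∀ i, (f i).isSome then some fun i => (f i).get (h i) else none

/-! ## The domain `D`: atoms (Herbrand terms) plus, at each finite level,
all sets of (nonempty) tuples over the previous level.
We realise it as the quotient of a type of "pre-domain elements" of finite
rank by extensional equivalence. -/

/-- Pre-domain elements over a type `A` of atoms: an atom, or a set of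
nonempty tuples (each tuple encoded as head + tail), indexed by an arbitrary
(small) index type. -/
inductive PD (A : Type) : Type 1
  | atom : A → PD A
  | set : (ι : Type) → (ι → PD A) → (ι → List (PD A)) → PD A

/-- `x` has rank at most `n` (atoms have rank `0`). -/
def PD.rankLe {A : Type} : ℕ → PD A → Prop
  | 0, .atom _ => True
  | 0, .set _ _ _ => False
  | _ + 1, .atom _ => True
  | n + 1, .set _ hd tl => ∀ i, PD.rankLe n (hd i) ∧ ∀ z ∈ tl i, PD.rankLe n z

/-- Finite rank: the element appears at some finite level `D^i` of the
domain hierarchy. -/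
def PD.FiniteRank {A : Type} (x : PD A) : Prop := ∃ n, PD.rankLe n x

/-- Extensional equivalence up to depth `n`. -/
def PD.EquivLe {A : Type} : ℕ → PD A → PD A → Prop
  | 0, .atom a, .atom b => a = b
  | 0, _, _ => False
  | _ + 1, .atom a, .atom b => a = b
  | n + 1, .set _ hd tl, .set _ hd' tl' =>
      (∀ i, ∃ j, PD.EquivLe n (hd i) (hd' j) ∧ List.Forall₂ (PD.EquivLe n) (tl i) (tl' j)) ∧
      (∀ j, ∃ i, PD.EquivLe n (hd i) (hd' j) ∧ List.Forall₂ (PD.EquivLe n) (tl i) (tl' j))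
  | _ + 1, _, _ => False

/-- Extensional equivalence (witnessed at some finite depth). -/
def PD.Equiv {A : Type} (x y : PD A) : Prop := ∃ n, PD.EquivLe n x y

/-- The domain over atoms `A`: finite-rank pre-domain elements modulo
extensional equivalence. -/
def DD (A : Type) : Type 1 :=
  Quot fun x y : { z : PD A // z.FiniteRank } => PD.Equiv x.1 y.1

def toD {A : Type} (x : PD A) (h : x.FiniteRank) : DD A := Quot.mk _ ⟨x, h⟩

def atomD {A : Type} (a : A) : DD A := toD (PD.atom a) ⟨0, by simp [PD.rankLe]⟩

/-- `z` (a pre-domain element) represents the domain element `w`. -/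
def repD {A : Type} (z : PD A) (w : DD A) : Prop := ∃ h, w = toD z h

/-- Membership of a tuple in a domain element (meaningful when the latter
is a set). -/
def dmem {A : Type} (v : Tup (DD A)) (d : DD A) : Prop :=
  ∃ (ι : Type) (hd : ι → PD A) (tl : ι → List (PD A)) (hfr : (PD.set ι hd tl).FiniteRank),
    d = toD (PD.set ι hd tl) hfr ∧ ∃ i, repD (hd i) v.1 ∧ List.Forall₂ repD (tl i) v.2

/-- The domain elements that are sets (the subset `𝒮 = D ∖ D⁰`). -/
def IsSetD {A : Type} (d : DD A) : Prop :=
  ∃ (ι : Type) (hd : ι → PD A) (tl : ι → List (PD A)) (hfr : (PD.set ι hd tl).FiniteRank),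
    d = toD (PD.set ι hd tl) hfr

/-- The domain element whose members are exactly the tuples in `s`
(`none` if there is no such element of the domain). -/
def mkSet? {A : Type} (s : Set (Tup (DD A))) : Option (DD A) :=
  if h : ∃ d : DD A, IsSetD d ∧ ∀ v, dmem v d ↔ v ∈ s then some h.choose else none


universe v

/-! ## Signatures -/

/-- A signature: Herbrand function (constructor) names `C`, evaluable
function names `F`, and predicate names `P`, each with an arity, with at
least one Herbrand constant. -/
structure Sig : Type (v + 1) where
  C : Type
  arC : C → ℕ
  F : Type v
  arF : F → ℕ
  P : Type
  arP : P → ℕ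
  hasConst : ∃ c, arC c = 0

/-- Ground Herbrand terms over constructors `C`. -/
inductive HTerm (C : Type) (ar : C → ℕ) : Type
  | mk : (c : C) → (Fin (ar c) → HTerm C ar) → HTerm C ar

/-- The domain `D` of a signature: the Herbrand universe `Terms_F(C)`
together with all (finite-level) sets of nonempty tuples over it. -/
abbrev D (S : Sig.{v}) : Type 1 := DD (HTerm S.C S.arC)

/-! ## Terms and formulas (with extensional and intensional sets).
Quantified variables and the variables bound by an intensional set are
handled by substitution of arbitrary domain elements (which are available
as constant terms via `GTerm.dom`), so terms and formulas below are the
*ground* terms and *sentences* of the language. -/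

mutual
  inductive GTerm (S : Sig.{v}) : Type (max 1 v)
    /-- every element of the domain is a (ground) term -/
    | dom : D S → GTerm S
    /-- Herbrand (constructor) function application -/
    | ctor : (c : S.C) → (Fin (S.arC c) → GTerm S) → GTerm S
    /-- evaluable function application -/
    | func : (f : S.F) → (Fin (S.arF f) → GTerm S) → GTerm S
    /-- extensional set `{τ⃗₁, …, τ⃗_m}` of `m` tuples of terms, each of
    arity `n+1` -/
    | eset : (m n : ℕ) → (Fin m → Fin (n + 1) → GTerm S) → GTerm S
    /-- intensional set `{x⃗ : τ⃗(x⃗) : φ(x⃗)}` with `k` bound variables and a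
    tuple of `n+1` terms -/
    | iset : (k n : ℕ) → ((Fin k → D S) → Fin (n + 1) → GTerm S) →
        ((Fin k → D S) → Formula S) → GTerm S

  inductive Formula (S : Sig.{v}) : Type (max 1 v)
    | falsum : Formula S
    | verum : Formula S
    | atom : (p : S.P) → (Fin (S.arP p) → GTerm S) → Formula S
    | eq : GTerm S → GTerm S → Formula S
    | and : Formula S → Formula S → Formula S
    | or : Formula S → Formula S → Formula S
    | imp : Formula S → Formula S → Formula S
    | all : (D S → Formula S) → Formula S
    | ex : (D S → Formula S) → Formula S
end

/-- `¬φ` is an abbreviation for `φ → ⊥`. -/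
def Formula.neg {S : Sig.{v}} (φ : Formula S) : Formula S := .imp φ .falsum

/-- Ground atoms over the domain: the Herbrand base. -/
def GAtom (S : Sig.{v}) : Type 1 := Σ p : S.P, Fin (S.arP p) → D S

/-! ## Assignments and interpretations -/

/-- An assignment maps every ground term to a domain element or `none`
(undefined, `u`). -/
abbrev Assign (S : Sig.{v}) := GTerm S → Option (D S)

/-- The conditions an assignment must satisfy: identity on domain
constants, strictness and substitutivity for function application, the
Herbrand interpretation of constructors on atoms, and evaluation of
extensional set terms. -/
def AssignValid {S : Sig.{v}} (σ : Assign S) : Prop :=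
  (∀ d, σ (.dom d) = some d) ∧
  (∀ c args, (∃ i, σ (args i) = none) → σ (.ctor c args) = none) ∧
  (∀ c args (ds : Fin (S.arC c) → D S), (∀ i, σ (args i) = some (ds i)) →
      σ (.ctor c args) = σ (.ctor c fun i => .dom (ds i))) ∧
  (∀ c (hs : Fin (S.arC c) → HTerm S.C S.arC),
      σ (.ctor c fun i => .dom (atomD (hs i))) = some (atomD (HTerm.mk c hs))) ∧
  (∀ f args, (∃ i, σ (args i) = none) → σ (.func f args) = none) ∧
  (∀ f args (ds : Fin (S.arF f) → D S), (∀ i, σ (args i) = some (ds i)) →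
      σ (.func f args) = σ (.func f fun i => .dom (ds i))) ∧
  (∀ m n tups, (∃ j i, σ (tups j i) = none) → σ (.eset m n tups) = none) ∧
  (∀ m n tups (ds : Fin m → Fin (n + 1) → D S), (∀ j i, σ (tups j i) = some (ds j i)) →
      σ (.eset m n tups) = mkSet? { v | ∃ j, v = famToTup (ds j) })

/-- `σ ≼ σ'` : on every ground term, `σ` agrees with `σ'` or is undefined. -/
def AssignLe {S : Sig.{v}} (σ σ' : Assign S) : Prop :=
  ∀ τ, σ τ = σ' τ ∨ σ τ = none

/-- An interpretation `⟨σʰ, σᵗ, Iʰ, Iᵗ⟩`. -/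
structure Interp (S : Sig.{v}) : Type (max 1 v) where
  sh : Assign S
  st : Assign S
  Ih : Set (GAtom S)
  It : Set (GAtom S)

/-- The assignment of `I` at world `w`. -/
def Interp.s {S : Sig.{v}} (I : Interp S) : W → Assign S
  | .h => I.sh
  | .t => I.st

/-- The atoms of `I` at world `w`. -/
def Interp.atoms {S : Sig.{v}} (I : Interp S) : W → Set (GAtom S)
  | .h => I.Ih
  | .t => I.It

/-- The defining conditions of an interpretation: both assignments are
proper assignments, `σʰ ≼ σᵗ` and `Iʰ ⊆ Iᵗ`. -/
def Interp.Valid {S : Sig.{v}} (I : Interp S) : Prop :=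
  AssignValid I.sh ∧ AssignValid I.st ∧ AssignLe I.sh I.st ∧ I.Ih ⊆ I.It

/-! ## 𝒮-satisfaction -/

/-- `SatS I w φ` : `I, w ⊨_𝒮 φ`. -/
def SatS {S : Sig.{v}} (I : Interp S) : W → Formula S → Prop
  | _, .falsum => False
  | _, .verum => True
  | w, .atom p args => ∃ ds : Fin (S.arP p) → D S,
      (∀ i, I.s w (args i) = some (ds i)) ∧ (⟨p, ds⟩ : GAtom S) ∈ I.atoms w
  | w, .eq t1 t2 => ∃ d, I.s w t1 = some d ∧ I.s w t2 = some d
  | w, .and a b => SatS I w a ∧ SatS I w b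
  | w, .or a b => SatS I w a ∨ SatS I w b
  | w, .imp a b => ∀ w', W.le w w' → (SatS I w' a → SatS I w' b)
  | w, .all b => ∀ d, SatS I w (b d)
  | w, .ex b => ∃ d, SatS I w (b d)

/-! ## Extension of intensional sets and the coherent closure -/

/-- The extension `ext(I, w, {x⃗ : τ⃗(x⃗) : φ(x⃗)})`: the set of values of the
tuples `τ⃗(c⃗)` for those `c⃗ ∈ D^k` with `I, w ⊨_𝒮 φ(c⃗)`; it is undefined if
one of these values is undefined (or if the resulting collection is not a
member of the domain). -/
def extw {S : Sig.{v}} (I : Interp S) (w : W) (k n : ℕ)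
    (tv : (Fin k → D S) → Fin (n + 1) → GTerm S)
    (φ : (Fin k → D S) → Formula S) : Option (D S) :=
  if ∃ c : Fin k → D S, SatS I w (φ c) ∧ ∃ i, I.s w (tv c i) = none then none
  else
    mkSet? { val | ∃ (c : Fin k → D S) (ds : Fin (n + 1) → D S),
      SatS I w (φ c) ∧ (∀ i, I.s w (tv c i) = some (ds i)) ∧ val = famToTup ds }

/-- The assignment `σ_I^w` of the coherent closure of `I`: it agrees with
`σ^w` on terms without intensional sets, it assigns to an intensional set
its extension at `t`, at `h` its extension when the two extensions agree
(and `u` otherwise), and is extended to all remaining terms by the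
assignment conditions. -/
def cval {S : Sig.{v}} (I : Interp S) (w : W) : GTerm S → Option (D S)
  | .dom d => some d
  | .ctor c args =>
      match optFam fun i => cval I w (args i) with
      | none => none
      | some ds => I.s w (.ctor c fun i => .dom (ds i))
  | .func f args =>
      match optFam fun i => cval I w (args i) with
      | none => none
      | some ds => I.s w (.func f fun i => .dom (ds i))
  | .eset _ _ tups =>
      match optFam fun j => optFam fun i => cval I w (tups j i) with
      | none => none
      | some g => mkSet? { val | ∃ j, val = famToTup (g j) }
  | .iset k n tv φ =>
      match w with
      | .t => extw I .t k n tv φ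
      | .h => if extw I .h k n tv φ = extw I .t k n tv φ then extw I .h k n tv φ else none

/-- The coherent closure `C(I)` of an interpretation. -/
def CohC {S : Sig.{v}} (I : Interp S) : Interp S :=
  ⟨cval I .h, cval I .t, I.Ih, I.It⟩

/-- `I` is coherent (w.r.t. intensional sets) iff `I = C(I)`. -/
def Interp.Coherent {S : Sig.{v}} (I : Interp S) : Prop := CohC I = I

/-! ## 0-formulas (no intensional sets) and `SQHT⁼_F` over `⟨C ∪ 𝒮, F, P⟩`.
A `0`-formula over `Σ = ⟨C, F, P⟩` is at the same time an `SQHT⁼_F` formula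
over the signature `⟨C ∪ 𝒮, F, P⟩`, whose Herbrand universe is the domain
`D`.  An `SQHT⁼_F` interpretation over `⟨C ∪ 𝒮, F, P⟩` is an interpretation
whose assignments are only defined on terms without intensional sets. -/

mutual
  def IsZeroT {S : Sig.{v}} : GTerm S → Prop
    | .dom _ => True
    | .ctor _ args => ∀ i, IsZeroT (args i)
    | .func _ args => ∀ i, IsZeroT (args i)
    | .eset _ _ tups => ∀ j i, IsZeroT (tups j i)
    | .iset _ _ _ _ => False

  def IsZeroF {S : Sig.{v}} : Formula S → Prop
    | .falsum => True
    | .verum => True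
    | .atom _ args => ∀ i, IsZeroT (args i)
    | .eq t1 t2 => IsZeroT t1 ∧ IsZeroT t2
    | .and a b => IsZeroF a ∧ IsZeroF b
    | .or a b => IsZeroF a ∧ IsZeroF b
    | .imp a b => IsZeroF a ∧ IsZeroF b
    | .all b => ∀ d, IsZeroF (b d)
    | .ex b => ∀ d, IsZeroF (b d)
end

/-- An `SQHT⁼_F` interpretation over `⟨C ∪ 𝒮, F, P⟩`: assignments are given
on the terms without intensional sets only. -/
structure FInterp (S : Sig.{v}) : Type (max 1 v) where
  sh : { τ : GTerm S // IsZeroT τ } → Option (D S)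
  st : { τ : GTerm S // IsZeroT τ } → Option (D S)
  Ih : Set (GAtom S)
  It : Set (GAtom S)

/-- The restriction `Î` of an `SQHT⁼_𝒮` interpretation to the terms without
intensional sets. -/
def Interp.hat {S : Sig.{v}} (I : Interp S) : FInterp S :=
  ⟨fun τ => I.sh τ.1, fun τ => I.st τ.1, I.Ih, I.It⟩

/-- The canonical extension of an `SQHT⁼_F` interpretation to all terms
(undefined outside terms without intensional sets); it is used to evaluate
`SQHT⁼_F` satisfaction, which only depends on the values on terms without
intensional sets. -/
def FInterp.toInterp {S : Sig.{v}} (J : FInterp S) : Interp S :=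
  ⟨fun τ => if h : IsZeroT τ then J.sh ⟨τ, h⟩ else none,
   fun τ => if h : IsZeroT τ then J.st ⟨τ, h⟩ else none, J.Ih, J.It⟩

/-- `SQHT⁼_F` satisfaction `I, w ⊨_F φ` (for `0`-formulas `φ`, i.e.
`SQHT⁼_F` formulas over `⟨C ∪ 𝒮, F, P⟩`): the same clauses as `⊨_𝒮`, with
quantifiers ranging over the Herbrand universe of `⟨C ∪ 𝒮, F, P⟩`. -/
def SatF {S : Sig.{v}} (J : FInterp S) (w : W) (φ : Formula S) : Prop :=
  SatS J.toInterp w φ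

/-- Validity of an `SQHT⁼_F` interpretation. -/
def FInterp.Valid {S : Sig.{v}} (J : FInterp S) : Prop := J.toInterp.Valid

/-! ## Orderings between interpretations, equilibrium and stable models -/

/-- `I₁ ≼ I₂` : same `there` component, smaller `here` component. -/
def ILe {S : Sig.{v}} (I1 I2 : Interp S) : Prop :=
  I1.It = I2.It ∧ I1.st = I2.st ∧ I1.Ih ⊆ I2.Ih ∧ AssignLe I1.sh I2.sh

/-- `I₁ ≺ I₂`. -/
def ILt {S : Sig.{v}} (I1 I2 : Interp S) : Prop := ILe I1 I2 ∧ I1 ≠ I2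

/-- The total interpretation `⟨σ, T⟩`. -/
def totalI {S : Sig.{v}} (σ : Assign S) (T : Set (GAtom S)) : Interp S := ⟨σ, σ, T, T⟩

/-- `I` is a model of the theory `Γ` : `I` is a (coherent) interpretation
and `I, h ⊨_𝒮 φ` for every `φ ∈ Γ`. -/
def ModelS {S : Sig.{v}} (I : Interp S) (Γ : Set (Formula S)) : Prop :=
  I.Valid ∧ I.Coherent ∧ ∀ φ ∈ Γ, SatS I .h φ

/-- `⟨σ, T⟩` is an equilibrium model of `Γ`. -/
def EqModelS {S : Sig.{v}} (Γ : Set (Formula S)) (σ : Assign S) (T : Set (GAtom S)) : Prop :=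
  ModelS (totalI σ T) Γ ∧ ∀ I', ILt I' (totalI σ T) → ¬ ModelS I' Γ

/-- `T` is a stable model of `Γ` (`SQHT⁼_𝒮` equilibrium semantics). -/
def StableS {S : Sig.{v}} (Γ : Set (Formula S)) (T : Set (GAtom S)) : Prop :=
  ∃ σ, EqModelS Γ σ T

/-- The ordering on `SQHT⁼_F` assignments. -/
def FAssignLe {S : Sig.{v}} (σ σ' : { τ : GTerm S // IsZeroT τ } → Option (D S)) : Prop :=
  ∀ τ, σ τ = σ' τ ∨ σ τ = none

/-- `≼` on `SQHT⁼_F` interpretations. -/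
def FILe {S : Sig.{v}} (J1 J2 : FInterp S) : Prop :=
  J1.It = J2.It ∧ J1.st = J2.st ∧ J1.Ih ⊆ J2.Ih ∧ FAssignLe J1.sh J2.sh

def FILt {S : Sig.{v}} (J1 J2 : FInterp S) : Prop := FILe J1 J2 ∧ J1 ≠ J2

def totalF {S : Sig.{v}} (σ : { τ : GTerm S // IsZeroT τ } → Option (D S))
    (T : Set (GAtom S)) : FInterp S := ⟨σ, σ, T, T⟩

/-- `J` is an `SQHT⁼_F` model of `Γ`. -/
def ModelF {S : Sig.{v}} (J : FInterp S) (Γ : Set (Formula S)) : Prop :=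
  J.Valid ∧ ∀ φ ∈ Γ, SatF J .h φ

/-- `T` is a stable model of `Γ` under the `SQHT⁼_F` equilibrium semantics
over the signature `⟨C ∪ 𝒮, F, P⟩`. -/
def StableF {S : Sig.{v}} (Γ : Set (Formula S)) (T : Set (GAtom S)) : Prop :=
  ∃ σ, ModelF (totalF σ T) Γ ∧ ∀ J', FILt J' (totalF σ T) → ¬ ModelF J' Γ
/-! ## Aggregates and the language `𝒜log` of Gelfond–Zhang. -/

/-- Arithmetic comparison relations. -/
inductive CmpOp : Type
  | eq
  | le
  | ge
  | lt
  | gt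
  | ne

def CmpOp.eval : CmpOp → ℤ → ℤ → Prop
  | .eq => fun a b => a = b
  | .le => fun a b => a ≤ b
  | .ge => fun a b => a ≥ b
  | .lt => fun a b => a < b
  | .gt => fun a b => a > b
  | .ne => fun a b => a ≠ b

/-- Extra structure on a signature for aggregates and arithmetic:
a set `𝒜` of unary aggregate names among the evaluable functions, each with
its associated function `f̂` (whose value is only relevant on the sets `𝒮`),
integer constants among the Herbrand constants, and arithmetic comparison
predicates. -/
structure GZExt (S : Sig.{0}) : Type 1 where
  isAgg : S.F → Prop
  agg_ar : ∀ f, isAgg f → S.arF f = 1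
  hat : S.F → D S → Option (D S)
  intC : ℤ → S.C
  int_ar : ∀ z, S.arC (intC z) = 0
  int_inj : Function.Injective intC
  cmpP : CmpOp → S.P
  cmp_ar : ∀ o, S.arP (cmpP o) = 2
  cmp_inj : Function.Injective cmpP

/-- The integer `z` as an element of the domain (a Herbrand constant). -/
def intD {S : Sig.{0}} (G : GZExt S) (z : ℤ) : D S :=
  atomD (HTerm.mk (G.intC z) fun i => Fin.elim0 (Fin.cast (G.int_ar z) i))

/-- The arithmetic comparison predicates have their standard meanings in
the interpretation `I`. -/
def ArithStd {S : Sig.{0}} (G : GZExt S) (I : Interp S) : Prop :=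
  ∀ (o : CmpOp) (ds : Fin (S.arP (G.cmpP o)) → D S) (w : W),
    (⟨G.cmpP o, ds⟩ : GAtom S) ∈ I.atoms w ↔
      ∃ a b : ℤ, ds (Fin.cast (G.cmp_ar o).symm 0) = intD G a ∧
        ds (Fin.cast (G.cmp_ar o).symm 1) = intD G b ∧ o.eval a b

/-- `I` is coherent w.r.t. aggregates: coherent w.r.t. intensional sets
and, for every aggregate name `f` and ground term `τ`,
`σʷ(f(τ)) = f̂(σʷ(τ))` whenever `σʷ(τ) ∈ 𝒮`, and `σᵗ(f(τ)) = u` otherwise. -/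
def AggCoherent {S : Sig.{0}} (G : GZExt S) (I : Interp S) : Prop :=
  I.Coherent ∧
    ∀ f, G.isAgg f → ∀ τ : GTerm S,
      (∀ w d, I.s w τ = some d → IsSetD d → I.s w (.func f fun _ => τ) = G.hat f d) ∧
      (¬ (∃ d, I.st τ = some d ∧ IsSetD d) → I.st (.func f fun _ => τ) = none)

/-! ### GZ formulas -/

/-- Ground GZ formulas without set atoms: built from (ground) predicate
atoms by `∧`, `∨`, `→` (and `⊥`).  These are the `0`-formulas allowed as
the condition of a GZ set name. -/
inductive GZB (S : Sig.{0}) : Type 1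
  | falsum : GZB S
  | patom : (p : S.P) → (Fin (S.arP p) → D S) → GZB S
  | and : GZB S → GZB S → GZB S
  | or : GZB S → GZB S → GZB S
  | imp : GZB S → GZB S → GZB S

/-- Ground GZ formulas: predicate atoms and set atoms
`f{x⃗ : φ(x⃗)} ⊴ n` (with `f` an aggregate name, `k+1` bound variables,
`φ` a `0`-formula and `n` an integer), combined by `∧`, `∨`, `→`. -/
inductive GZG {S : Sig.{0}} (G : GZExt S) : Type 1
  | falsum : GZG G
  | patom : (p : S.P) → (Fin (S.arP p) → D S) → GZG G
  | satom : (f : S.F) → G.isAgg f → (k : ℕ) →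
      ((Fin (k + 1) → D S) → GZB S) → CmpOp → ℤ → GZG G
  | and : GZG G → GZG G → GZG G
  | or : GZG G → GZG G → GZG G
  | imp : GZG G → GZG G → GZG G

/-- Classical satisfaction `T ⊨_cl` for formulas without set atoms. -/
def SatB {S : Sig.{0}} (T : Set (GAtom S)) : GZB S → Prop
  | .falsum => False
  | .patom p ds => (⟨p, ds⟩ : GAtom S) ∈ T
  | .and a b => SatB T a ∧ SatB T b
  | .or a b => SatB T a ∨ SatB T b
  | .imp a b => SatB T a → SatB T b

/-- Classical satisfaction `T ⊨_cl` for ground GZ formulas.  For a set atom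
`f{x⃗ : φ(x⃗)} ⊴ n`: `f̂` applied to the set `{c⃗ ∈ D^{|x⃗|} : T ⊨_cl φ(c⃗)}`
has some integer value `k` and `k ⊴ n` holds. -/
def SatG {S : Sig.{0}} {G : GZExt S} (T : Set (GAtom S)) : GZG G → Prop
  | .falsum => False
  | .patom p ds => (⟨p, ds⟩ : GAtom S) ∈ T
  | .satom f _ k body o n =>
      ∃ (d : D S) (z : ℤ),
        mkSet? { val | ∃ c : Fin (k + 1) → D S, SatB T (body c) ∧ val = famToTup c } = some d ∧
        G.hat f d = some (intD G z) ∧ o.eval z n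
  | .and a b => SatG T a ∧ SatG T b
  | .or a b => SatG T a ∨ SatG T b
  | .imp a b => SatG T a → SatG T b

/-- A formula without set atoms as an `SQHT⁼_𝒮` formula. -/
def GZB.toF {S : Sig.{0}} : GZB S → Formula S
  | .falsum => .falsum
  | .patom p ds => .atom p fun i => .dom (ds i)
  | .and a b => .and a.toF b.toF
  | .or a b => .or a.toF b.toF
  | .imp a b => .imp a.toF b.toF

/-- The set name `{x⃗ : φ(x⃗)}` (that is, `{x⃗ : x⃗ : φ(x⃗)}`) as an
intensional-set term. -/
def setName {S : Sig.{0}} (k : ℕ) (body : (Fin (k + 1) → D S) → GZB S) : GTerm S :=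
  .iset (k + 1) k (fun c i => .dom (c i)) fun c => (body c).toF

/-- The comparison atom `τ₁ ⊴ τ₂` as an `SQHT⁼_𝒮` formula. -/
def cmpAtom {S : Sig.{0}} (G : GZExt S) (o : CmpOp) (t1 t2 : GTerm S) : Formula S :=
  .atom (G.cmpP o) fun i => (fun j : Fin 2 => if j = 0 then t1 else t2) (Fin.cast (G.cmp_ar o) i)

/-- A ground GZ formula as an `SQHT⁼_𝒮` formula: the set atom
`f{x⃗ : φ(x⃗)} ⊴ n` becomes the atom `⊴(f({x⃗ : φ(x⃗)}), n)`. -/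
def GZG.toF {S : Sig.{0}} {G : GZExt S} : GZG G → Formula S
  | .falsum => .falsum
  | .patom p ds => .atom p fun i => .dom (ds i)
  | .satom f _ k body o n =>
      cmpAtom G o (.func f fun _ => setName k body) (.dom (intD G n))
  | .and a b => .and a.toF b.toF
  | .or a b => .or a.toF b.toF
  | .imp a b => .imp a.toF b.toF

/-- A GZ formula: the universal closure `∀x⃗ φ(x⃗)` of a ground GZ formula
with `k` free variables. -/
structure GZSent {S : Sig.{0}} (G : GZExt S) : Type 1 where
  k : ℕ
  body : (Fin k → D S) → GZG G

/-- Iterated universal quantification over `k` variables. -/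
def allk {S : Sig.{0}} : (k : ℕ) → ((Fin k → D S) → Formula S) → Formula S
  | 0, f => f fun i => i.elim0
  | k + 1, f => .all fun d => allk k fun c => f (Fin.cons d c)

/-- A GZ formula as an `SQHT⁼_𝒮` formula (its universal closure). -/
def GZSent.toF {S : Sig.{0}} {G : GZExt S} (s : GZSent G) : Formula S :=
  allk s.k fun c => (s.body c).toF

/-- The grounding `Gr(Γ)` of a GZ theory: all ground instances of its
formulas. -/
def GrOf {S : Sig.{0}} {G : GZExt S} (Γ : Set (GZSent G)) : Set (GZG G) :=
  { g | ∃ s ∈ Γ, ∃ c, g = s.body c }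

/-! ### Stable models on the `SQHT⁼_𝒮` side (with aggregates) -/

/-- `I` is a model (w.r.t. aggregates) of the theory `Γ`: `I` is an
interpretation, coherent w.r.t. aggregates, interpreting arithmetic
standardly, with `I, h ⊨_𝒮 φ` for every `φ ∈ Γ`. -/
def ModelAgg {S : Sig.{0}} (G : GZExt S) (I : Interp S) (Γ : Set (Formula S)) : Prop :=
  I.Valid ∧ AggCoherent G I ∧ ArithStd G I ∧ ∀ φ ∈ Γ, SatS I .h φ

/-- `T` is a stable model of `Γ` under the `SQHT⁼_𝒮` equilibrium semantics
with interpretations coherent w.r.t. aggregates. -/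
def StableAgg {S : Sig.{0}} (G : GZExt S) (Γ : Set (Formula S)) (T : Set (GAtom S)) : Prop :=
  ∃ σ, ModelAgg G (totalI σ T) Γ ∧ ∀ I', ILt I' (totalI σ T) → ¬ ModelAgg G I' Γ

/-! ### The GZ reduct -/

/-- The target language of the GZ reduct: ground formulas with (possibly
infinitary) conjunctions. -/
inductive RForm (S : Sig.{0}) : Type 2
  | falsum : RForm S
  | patom : (p : S.P) → (Fin (S.arP p) → D S) → RForm S
  | and : RForm S → RForm S → RForm S
  | or : RForm S → RForm S → RForm S
  | imp : RForm S → RForm S → RForm S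
  | conj : (ι : Type 1) → (ι → RForm S) → RForm S

/-- Classical satisfaction for reduct formulas. -/
def SatR {S : Sig.{0}} (T : Set (GAtom S)) : RForm S → Prop
  | .falsum => False
  | .patom p ds => (⟨p, ds⟩ : GAtom S) ∈ T
  | .and a b => SatR T a ∧ SatR T b
  | .or a b => SatR T a ∨ SatR T b
  | .imp a b => SatR T a → SatR T b
  | .conj _ f => ∀ i, SatR T (f i)

/-- The reduct `φ^T` of a formula without set atoms. -/
def GZB.reduct {S : Sig.{0}} (T : Set (GAtom S)) : GZB S → RForm S
  | .falsum => .falsum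
  | .patom p ds => if (⟨p, ds⟩ : GAtom S) ∈ T then .patom p ds else .falsum
  | .and a b => if SatB T (.and a b) then .and (a.reduct T) (b.reduct T) else .falsum
  | .or a b => if SatB T (.or a b) then .or (a.reduct T) (b.reduct T) else .falsum
  | .imp a b => if SatB T (.imp a b) then .imp (a.reduct T) (b.reduct T) else .falsum

/-- The GZ reduct `φ^T` of a ground GZ formula w.r.t. `T`: `⊥` if
`T ⊭_cl φ`; a satisfied set atom `f{x⃗ : ψ(x⃗)} ⊴ n` becomes
`(⋀ Gr⁺_T(ψ(x⃗)))^T`, the conjunction of the reducts of all ground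
instances of `ψ` classically satisfied by `T`. -/
def GZG.reduct {S : Sig.{0}} {G : GZExt S} (T : Set (GAtom S)) : GZG G → RForm S
  | .falsum => .falsum
  | .patom p ds => if (⟨p, ds⟩ : GAtom S) ∈ T then .patom p ds else .falsum
  | .satom f hf k body o n =>
      if SatG T (.satom f hf k body o n) then
        .conj { c : Fin (k + 1) → D S // SatB T (body c) } fun c => (body c.1).reduct T
      else .falsum
  | .and a b => if SatG T (.and a b) then .and (a.reduct T) (b.reduct T) else .falsum
  | .or a b => if SatG T (.or a b) then .or (a.reduct T) (b.reduct T) else .falsum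
  | .imp a b => if SatG T (.imp a b) then .imp (a.reduct T) (b.reduct T) else .falsum

/-- `T` is the `⊆`-minimal (classical) model of a set of reduct formulas. -/
def MinModel {S : Sig.{0}} (T : Set (GAtom S)) (Φ : Set (RForm S)) : Prop :=
  (∀ ψ ∈ Φ, SatR T ψ) ∧ ∀ T' ⊆ T, (∀ ψ ∈ Φ, SatR T' ψ) → T' = T

/-- `T` is a GZ-stable model of the GZ theory `Γ`: `T` is the `⊆`-minimal
model of the reduct `Gr(Γ)^T`. -/
def GZStable {S : Sig.{0}} {G : GZExt S} (Γ : Set (GZSent G)) (T : Set (GAtom S)) : Prop :=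
  MinModel T { r | ∃ g ∈ GrOf Γ, r = GZG.reduct T g }
/-! ## Statement 19: the concrete program
`{ p(b),  count{X : p(X)} ≥ 1 → p(a) }` has no stable model. -/

/-- The two Herbrand constants `a` and `b`. -/
inductive AB : Type
  | a
  | b

/-- Predicate names: the unary predicate `p` and the binary arithmetic
comparison predicates. -/
inductive P19 : Type
  | p
  | cmp (o : CmpOp)

/-- The signature: Herbrand constants `a`, `b` (together with the integer
constants), the unary aggregate name `count`, the unary predicate `p` and
the arithmetic comparison predicates. -/
def Sig19 : Sig.{0} where
  C := AB ⊕ ℤ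
  arC := fun _ => 0
  F := Unit
  arF := fun _ => 1
  P := P19
  arP := fun q => match q with
    | .p => 1
    | .cmp _ => 2
  hasConst := ⟨Sum.inl AB.a, rfl⟩

/-- The integer `z` as a domain element. -/
def intD19 (z : ℤ) : D Sig19 :=
  atomD (HTerm.mk (Sum.inr z) fun i => Fin.elim0 i)

/-- The aggregate structure: `count` is an aggregate whose associated
function maps a finite set to the number of its elements (and is undefined
otherwise). -/
def G19 : GZExt Sig19 where
  isAgg := fun _ => True
  agg_ar := fun _ _ => rfl
  hat := fun _ d =>
    if IsSetD d ∧ { v | dmem v d }.Finite then some (intD19 ({ v | dmem v d }.ncard : ℤ))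
    else none
  intC := Sum.inr
  int_ar := fun _ => rfl
  int_inj := Sum.inr_injective
  cmpP := P19.cmp
  cmp_ar := fun _ => rfl
  cmp_inj := fun _ _ h => by injection h

def aD : D Sig19 := atomD (HTerm.mk (Sum.inl AB.a) fun i => Fin.elim0 i)

def bD : D Sig19 := atomD (HTerm.mk (Sum.inl AB.b) fun i => Fin.elim0 i)

/-- The fact `p(b)`. -/
def fact19 : Formula Sig19 :=
  GZG.toF (G := G19) (.patom P19.p fun _ => bD)

/-- The rule `count{X : p(X)} ≥ 1 → p(a)`. -/
def rule19 : Formula Sig19 :=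
  GZG.toF (G := G19)
    (.imp (.satom () trivial 0 (fun c => .patom P19.p fun _ => c 0) .ge 1)
      (.patom P19.p fun _ => aD))

/-! ## Auxiliary facts about the domain -/

theorem optFam_of_some {α : Type u} {m : ℕ} {f : Fin m → Option α} {ds : Fin m → α}
    (h : ∀ i, f i = some (ds i)) : optFam f = some ds := by
  have hs : ∀ i, (f i).isSome := fun i => by simp [h i]
  simp only [optFam, hs, implies_true, dite_true, Option.some.injEq]
  funext i
  simp [h i]

theorem eq_some_of_optFam {α : Type u} {m : ℕ} {f : Fin m → Option α} {ds : Fin m → α}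
    (h : optFam f = some ds) (i : Fin m) : f i = some (ds i) := by
  unfold optFam at h
  split_ifs at h with hs
  cases h
  simp

theorem optFam_of_none {α : Type u} {m : ℕ} {f : Fin m → Option α}
    (h : ∃ i, f i = none) : optFam f = none := by
  obtain ⟨i, hi⟩ := h
  unfold optFam
  rw [dif_neg]
  intro hs
  simpa [hi] using hs i

theorem mkSet?_spec {A : Type} {s : Set (Tup (DD A))} {d : DD A} (h : mkSet? s = some d) :
    IsSetD d ∧ ∀ v, dmem v d ↔ v ∈ s := by
  unfold mkSet? at h
  split_ifs at h with hd
  cases h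
  exact hd.choose_spec

theorem PD.EquivLe.eq_atom {A : Type} {n : ℕ} {a : A} {x : PD A}
    (h : PD.EquivLe n (.atom a) x) : x = .atom a := by
  cases n <;> cases x <;> simp_all [PD.EquivLe]

theorem PD.EquivLe.eq_atom' {A : Type} {n : ℕ} {a : A} {x : PD A}
    (h : PD.EquivLe n x (.atom a)) : x = .atom a := by
  cases n <;> cases x <;> simp_all [PD.EquivLe]

theorem PD.Equiv.atom_iff {A : Type} {x y : PD A} (h : PD.Equiv x y) (a : A) :
    x = .atom a ↔ y = .atom a := by
  obtain ⟨n, h⟩ := h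
  constructor
  · rintro rfl; exact h.eq_atom
  · rintro rfl; exact h.eq_atom'

theorem atomD_injective {A : Type} : Function.Injective (atomD : A → DD A) := by
  intro a b h
  have := congrArg (Quot.lift (fun x : { z : PD A // z.FiniteRank } => x.1 = PD.atom a)
    fun x y hxy => propext (PD.Equiv.atom_iff hxy a)) h
  simpa [atomD, toD, eq_comm] using this

/-- `x` is a set all of whose members are the one-element tuple of the atom `a`. -/
def PD.SubSingletonAtom {A : Type} (a : A) : PD A → Prop
  | .atom _ => False
  | .set _ hd tl => ∀ i, hd i = .atom a ∧ tl i = []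

theorem PD.Equiv.subSingletonAtom_iff {A : Type} {x y : PD A} (h : PD.Equiv x y) (a : A) :
    x.SubSingletonAtom a ↔ y.SubSingletonAtom a := by
  obtain ⟨n, h⟩ := h
  cases n <;> cases x <;> cases y <;> simp only [PD.EquivLe] at h <;>
    simp only [PD.SubSingletonAtom]
  obtain ⟨h1, h2⟩ := h
  constructor
  · intro hx j
    obtain ⟨i, hi, ht⟩ := h2 j
    rw [(hx i).1] at hi
    rw [(hx i).2] at ht
    exact ⟨hi.eq_atom, by simpa using ht⟩
  · intro hy i
    obtain ⟨j, hj, ht⟩ := h1 i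
    rw [(hy j).1] at hj
    rw [(hy j).2] at ht
    exact ⟨hj.eq_atom', by simpa using ht⟩

theorem exists_singleton_atomD {A : Type} (a : A) :
    ∃ d : DD A, IsSetD d ∧ ∀ v, dmem v d ↔ v = (atomD a, []) := by
  have hfr : (PD.set Unit (fun _ => PD.atom a) fun _ => []).FiniteRank :=
    ⟨1, by simp [PD.rankLe]⟩
  refine ⟨toD _ hfr, ⟨_, _, _, hfr, rfl⟩, fun v => ⟨?_, ?_⟩⟩
  · rintro ⟨ι, hd, tl, hfr', he, i, ⟨hr, hv⟩, ht⟩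
    have := congrArg (Quot.lift
      (fun x : { z : PD A // z.FiniteRank } => x.1.SubSingletonAtom a)
      fun x y hxy => propext (PD.Equiv.subSingletonAtom_iff hxy a)) he
    have hs : (PD.set ι hd tl).SubSingletonAtom a := by
      simpa [toD, PD.SubSingletonAtom] using this
    obtain ⟨hi, hti⟩ := hs i
    rw [hti] at ht
    refine Prod.ext ?_ (by simpa using ht)
    rw [hv]
    simp only [hi]
    rfl
  · rintro rfl
    exact ⟨_, _, _, hfr, rfl, (), ⟨⟨0, by simp [PD.rankLe]⟩, rfl⟩, List.Forall₂.nil⟩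

theorem exists_mkSet?_singleton_atomD {A : Type} (a : A) :
    ∃ d : DD A, mkSet? {(atomD a, [])} = some d := by
  have h : ∃ d : DD A, IsSetD d ∧ ∀ v, dmem v d ↔ v ∈ ({(atomD a, [])} : Set (Tup (DD A))) :=
    exists_singleton_atomD a
  exact ⟨_, dif_pos h⟩

/-! ## Shrinking the `here` world of a total coherent interpretation -/

mutual
  /-- The value at `h` of a term in the coherent interpretation with `there` component
  `⟨σ, T⟩` and `here` atoms `H`. -/
  def hereVal {S : Sig.{0}} (σ : Assign S) (T H : Set (GAtom S)) : GTerm S → Option (D S)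
    | .dom d => some d
    | .ctor c args =>
        match optFam fun i => hereVal σ T H (args i) with
        | none => none
        | some ds => σ (.ctor c fun i => .dom (ds i))
    | .func f args =>
        match optFam fun i => hereVal σ T H (args i) with
        | none => none
        | some ds => σ (.func f fun i => .dom (ds i))
    | .eset _ _ tups =>
        match optFam fun j => optFam fun i => hereVal σ T H (tups j i) with
        | none => none
        | some g => mkSet? { val | ∃ j, val = famToTup (g j) }
    | .iset k n tv φ =>
        if (if ∃ c : Fin k → D S, (hereSat σ T H (φ c)).down ∧
              ∃ i, hereVal σ T H (tv c i) = none then none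
            else mkSet? { val | ∃ (c : Fin k → D S) (ds : Fin (n + 1) → D S),
              (hereSat σ T H (φ c)).down ∧ (∀ i, hereVal σ T H (tv c i) = some (ds i)) ∧
                val = famToTup ds }) = σ (.iset k n tv φ)
        then σ (.iset k n tv φ) else none

  /-- Satisfaction at `h` in the coherent interpretation with `there` component `⟨σ, T⟩`
  and `here` atoms `H`. -/
  def hereSat {S : Sig.{0}} (σ : Assign S) (T H : Set (GAtom S)) : Formula S → ULift.{1} Prop
    | .falsum => ⟨False⟩
    | .verum => ⟨True⟩
    | .atom p args => ⟨∃ ds : Fin (S.arP p) → D S,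
        (∀ i, hereVal σ T H (args i) = some (ds i)) ∧ (⟨p, ds⟩ : GAtom S) ∈ H⟩
    | .eq t1 t2 => ⟨∃ d, hereVal σ T H t1 = some d ∧ hereVal σ T H t2 = some d⟩
    | .and a b => ⟨(hereSat σ T H a).down ∧ (hereSat σ T H b).down⟩
    | .or a b => ⟨(hereSat σ T H a).down ∨ (hereSat σ T H b).down⟩
    | .imp a b => ⟨((hereSat σ T H a).down → (hereSat σ T H b).down) ∧
        (SatS (totalI σ T) .t a → SatS (totalI σ T) .t b)⟩
    | .all b => ⟨∀ d, (hereSat σ T H (b d)).down⟩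
    | .ex b => ⟨∃ d, (hereSat σ T H (b d)).down⟩
end

/-- The interpretation with `there` component `⟨σ, T⟩`, `here` atoms `H`, and the `here`
assignment forced by coherence. -/
def shrinkHere {S : Sig.{0}} (σ : Assign S) (T H : Set (GAtom S)) : Interp S :=
  ⟨hereVal σ T H, σ, H, T⟩

theorem satS_imp_here {S : Sig.{0}} {I : Interp S} {a b : Formula S} :
    SatS I .h (.imp a b) ↔ (SatS I .h a → SatS I .h b) ∧ (SatS I .t a → SatS I .t b) := by
  simp only [SatS]
  exact ⟨fun h => ⟨h .h trivial, h .t trivial⟩, fun h w _ => by cases w; exacts [h.1, h.2]⟩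

theorem satS_there_congr {S : Sig.{0}} {I J : Interp S} (hs : I.st = J.st) (ha : I.It = J.It) :
    (φ : Formula S) → (SatS I .t φ ↔ SatS J .t φ)
  | .falsum => by simp [SatS]
  | .verum => by simp [SatS]
  | .atom p args => by simp only [SatS, Interp.s, Interp.atoms, hs, ha]
  | .eq t1 t2 => by simp only [SatS, Interp.s, hs]
  | .and a b => by
      simp only [SatS, satS_there_congr hs ha a, satS_there_congr hs ha b]
  | .or a b => by
      simp only [SatS, satS_there_congr hs ha a, satS_there_congr hs ha b]
  | .imp a b => by
      simp only [SatS]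
      refine forall_congr' fun w => ?_
      cases w
      · simp [W.le]
      · simp only [satS_there_congr hs ha a, satS_there_congr hs ha b]
  | .all b => by
      simp only [SatS]
      exact forall_congr' fun d => satS_there_congr hs ha (b d)
  | .ex b => by
      simp only [SatS]
      exact exists_congr fun d => satS_there_congr hs ha (b d)

theorem extw_there_congr {S : Sig.{0}} {I J : Interp S} (hs : I.st = J.st) (ha : I.It = J.It)
    (k n : ℕ) (tv : (Fin k → D S) → Fin (n + 1) → GTerm S) (φ : (Fin k → D S) → Formula S) :
    extw I .t k n tv φ = extw J .t k n tv φ := by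
  simp only [extw, satS_there_congr hs ha, Interp.s, hs]
  congr

theorem cval_there_congr {S : Sig.{0}} {I J : Interp S} (hs : I.st = J.st) (ha : I.It = J.It) :
    (τ : GTerm S) → cval I .t τ = cval J .t τ
  | .dom d => by simp only [cval]
  | .ctor c args => by
      simp only [cval, fun i => cval_there_congr hs ha (args i), Interp.s, hs]
  | .func f args => by
      simp only [cval, fun i => cval_there_congr hs ha (args i), Interp.s, hs]
  | .eset m n tups => by
      simp only [cval, fun j i => cval_there_congr hs ha (tups j i)]
  | .iset k n tv φ => by
      simp only [cval]
      exact extw_there_congr hs ha k n tv φ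

theorem satS_shrinkHere {S : Sig.{0}} (σ : Assign S) (T H : Set (GAtom S)) :
    (φ : Formula S) → (SatS (shrinkHere σ T H) .h φ ↔ (hereSat σ T H φ).down)
  | .falsum => by simp [SatS, hereSat]
  | .verum => by simp [SatS, hereSat]
  | .atom p args => by simp only [SatS, hereSat, Interp.s, Interp.atoms, shrinkHere]
  | .eq t1 t2 => by simp only [SatS, hereSat, Interp.s, shrinkHere]
  | .and a b => by
      simp only [SatS, hereSat, satS_shrinkHere σ T H a, satS_shrinkHere σ T H b]
  | .or a b => by
      simp only [SatS, hereSat, satS_shrinkHere σ T H a, satS_shrinkHere σ T H b]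
  | .imp a b => by
      have ht := satS_there_congr (I := shrinkHere σ T H) (J := totalI σ T) rfl rfl
      simp only [satS_imp_here, hereSat, satS_shrinkHere σ T H a, satS_shrinkHere σ T H b, ht]
  | .all b => by
      simp only [SatS, hereSat]
      exact forall_congr' fun d => satS_shrinkHere σ T H (b d)
  | .ex b => by
      simp only [SatS, hereSat]
      exact exists_congr fun d => satS_shrinkHere σ T H (b d)

theorem extw_total_eq {S : Sig.{0}} {σ : Assign S} {T : Set (GAtom S)}
    (hc : (totalI σ T).Coherent) (k n : ℕ) (tv : (Fin k → D S) → Fin (n + 1) → GTerm S)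
    (φ : (Fin k → D S) → Formula S) :
    extw (totalI σ T) .t k n tv φ = σ (.iset k n tv φ) := by
  have h := congrFun (congrArg Interp.st hc) (.iset k n tv φ)
  simpa only [CohC, cval, totalI] using h

theorem hereVal_iset {S : Sig.{0}} {σ : Assign S} {T : Set (GAtom S)} (H : Set (GAtom S))
    (k n : ℕ) (tv : (Fin k → D S) → Fin (n + 1) → GTerm S) (φ : (Fin k → D S) → Formula S) :
    hereVal σ T H (.iset k n tv φ) =
      if extw (shrinkHere σ T H) .h k n tv φ = σ (.iset k n tv φ)
      then σ (.iset k n tv φ) else none := by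
  simp only [hereVal, extw, satS_shrinkHere]
  rfl

theorem cval_shrinkHere {S : Sig.{0}} {σ : Assign S} {T H : Set (GAtom S)}
    (hc : (totalI σ T).Coherent) (hv : AssignValid (hereVal σ T H)) :
    (τ : GTerm S) → cval (shrinkHere σ T H) .h τ = hereVal σ T H τ
  | .dom d => by simp only [cval, hereVal]
  | .ctor c args => by
      simp only [cval, fun i => cval_shrinkHere hc hv (args i)]
      cases h : optFam fun i => hereVal σ T H (args i) with
      | none => simp only [hereVal, h]
      | some ds => exact (hv.2.2.1 c args ds (eq_some_of_optFam h)).symm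
  | .func f args => by
      simp only [cval, fun i => cval_shrinkHere hc hv (args i)]
      cases h : optFam fun i => hereVal σ T H (args i) with
      | none => simp only [hereVal, h]
      | some ds => exact (hv.2.2.2.2.2.1 f args ds (eq_some_of_optFam h)).symm
  | .eset m n tups => by
      simp only [cval, hereVal, fun j i => cval_shrinkHere hc hv (tups j i)]
      rfl
  | .iset k n tv φ => by
      have ht := extw_there_congr (I := shrinkHere σ T H) (J := totalI σ T) rfl rfl k n tv φ
      simp only [cval, hereVal_iset, ht, extw_total_eq hc]
      split_ifs with h
      · exact h
      · rfl

theorem hereVal_valid {S : Sig.{0}} {σ : Assign S} (T H : Set (GAtom S)) (hσ : AssignValid σ) :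
    AssignValid (hereVal σ T H) := by
  obtain ⟨-, -, -, h4, -, -, -, -⟩ := hσ
  refine ⟨fun d => by simp only [hereVal], ?_, ?_, ?_, ?_, ?_, ?_, ?_⟩
  · intro c args h
    simp only [hereVal, optFam_of_none h]
  · intro c args ds h
    simp only [hereVal, optFam_of_some h, optFam_of_some (fun _ => rfl)]
  · intro c hs
    simp only [hereVal, optFam_of_some (fun _ => rfl), h4]
  · intro c args h
    simp only [hereVal, optFam_of_none h]
  · intro c args ds h
    simp only [hereVal, optFam_of_some h, optFam_of_some (fun _ => rfl)]
  · rintro m n tups ⟨j, h⟩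
    have h' : ∃ j, (optFam fun i => hereVal σ T H (tups j i)) = none := ⟨j, optFam_of_none h⟩
    simp only [hereVal, optFam_of_none h']
  · intro m n tups ds h
    simp only [hereVal, optFam_of_some fun j => optFam_of_some (h j)]

theorem hereVal_le {S : Sig.{0}} {σ : Assign S} (T H : Set (GAtom S)) (hσ : AssignValid σ) :
    (τ : GTerm S) → hereVal σ T H τ = σ τ ∨ hereVal σ T H τ = none
  | .dom d => by
      left
      simp only [hereVal, hσ.1]
  | .ctor c args => by
      simp only [hereVal]
      cases h : optFam fun i => hereVal σ T H (args i) with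
      | none => exact .inr rfl
      | some ds =>
        have hd := eq_some_of_optFam h
        refine .inl (hσ.2.2.1 c args ds fun i => ?_).symm
        rcases hereVal_le T H hσ (args i) with hi | hi
        · rw [← hi, hd i]
        · simp [hd i] at hi
  | .func f args => by
      simp only [hereVal]
      cases h : optFam fun i => hereVal σ T H (args i) with
      | none => exact .inr rfl
      | some ds =>
        have hd := eq_some_of_optFam h
        refine .inl (hσ.2.2.2.2.2.1 f args ds fun i => ?_).symm
        rcases hereVal_le T H hσ (args i) with hi | hi
        · rw [← hi, hd i]
        · simp [hd i] at hi
  | .eset m n tups => by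
      simp only [hereVal]
      cases h : optFam fun j => optFam fun i => hereVal σ T H (tups j i) with
      | none => exact .inr rfl
      | some g =>
        have hd := fun j => eq_some_of_optFam (eq_some_of_optFam h j)
        refine .inl (hσ.2.2.2.2.2.2.2 m n tups g fun j i => ?_).symm
        rcases hereVal_le T H hσ (tups j i) with hi | hi
        · rw [← hi, hd j i]
        · simp [hd j i] at hi
  | .iset k n tv φ => by
      rw [hereVal_iset]
      split_ifs
      · exact .inl rfl
      · exact .inr rfl

theorem shrinkHere_valid {S : Sig.{0}} {σ : Assign S} {T H : Set (GAtom S)}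
    (hσ : AssignValid σ) (hH : H ⊆ T) : (shrinkHere σ T H).Valid :=
  ⟨hereVal_valid T H hσ, hσ, hereVal_le T H hσ, hH⟩

theorem shrinkHere_coherent {S : Sig.{0}} {σ : Assign S} {T : Set (GAtom S)}
    (H : Set (GAtom S)) (hσ : AssignValid σ) (hc : (totalI σ T).Coherent) :
    (shrinkHere σ T H).Coherent := by
  have h1 : cval (shrinkHere σ T H) .h = hereVal σ T H :=
    funext (cval_shrinkHere hc (hereVal_valid T H hσ))
  have h2 : cval (shrinkHere σ T H) .t = σ := by
    have h := congrArg Interp.st hc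
    exact (funext (cval_there_congr (I := shrinkHere σ T H) (J := totalI σ T) rfl rfl)).trans h
  unfold Interp.Coherent CohC
  rw [h1, h2]
  rfl

theorem shrinkHere_aggCoherent {S : Sig.{0}} {G : GZExt S} {σ : Assign S} {T : Set (GAtom S)}
    (H : Set (GAtom S)) (hσ : AssignValid σ) (hc : AggCoherent G (totalI σ T)) :
    AggCoherent G (shrinkHere σ T H) := by
  refine ⟨shrinkHere_coherent H hσ hc.1, fun f hf τ => ⟨?_, (hc.2 f hf τ).2⟩⟩
  rintro (_ | _) d hd hset
  · have h : hereVal σ T H (.func f fun _ => τ) = σ (.func f fun _ => .dom d) := by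
      have hd' : ∀ i : Fin (S.arF f), hereVal σ T H ((fun _ => τ) i) = some d := fun _ => hd
      simp only [hereVal, optFam_of_some hd']
    exact h.trans ((hc.2 f hf (.dom d)).1 .t d (hσ.1 d) hset)
  · exact (hc.2 f hf τ).1 .t d hd hset

theorem shrinkHere_lt {S : Sig.{0}} {σ : Assign S} {T H : Set (GAtom S)}
    (hσ : AssignValid σ) (hH : H ⊂ T) : ILt (shrinkHere σ T H) (totalI σ T) :=
  ⟨⟨rfl, rfl, hH.subset, hereVal_le T H hσ⟩, fun h => hH.ne (congrArg Interp.Ih h)⟩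

/-! ## The program `{ p(b), count{X : p(X)} ≥ 1 → p(a) }` -/

/-- The ground atom `p(d)`. -/
def pAtom (d : D Sig19) : GAtom Sig19 := ⟨P19.p, fun _ => d⟩

theorem pAtom_injective : Function.Injective pAtom := by
  intro x y h
  have h' : (fun _ : Fin (Sig19.arP P19.p) => x) = fun _ => y := eq_of_heq (Sigma.mk.inj h).2
  exact congrFun h' (0 : Fin 1)

/-- The formula `p(d)`. -/
def pForm (d : D Sig19) : Formula Sig19 := .atom P19.p fun _ => .dom d

/-- The intensional set `{X : p(X)}`. -/
def pSet : GTerm Sig19 := setName (S := Sig19) 0 fun c => .patom P19.p fun _ => c 0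

/-- The term `count{X : p(X)}`. -/
def countP : GTerm Sig19 := .func () fun _ => pSet

/-- The atom `count{X : p(X)} ≥ 1`. -/
def countGe : Formula Sig19 := cmpAtom G19 .ge countP (.dom (intD19 1))

theorem satS_pForm {I : Interp Sig19} (hI : I.Valid) (w : W) (d : D Sig19) :
    SatS I w (pForm d) ↔ pAtom d ∈ I.atoms w := by
  have hdom : ∀ e, I.s w (.dom e) = some e := by
    cases w
    exacts [hI.1.1, hI.2.1.1]
  simp only [pForm, SatS, hdom]
  constructor
  · rintro ⟨ds, h, hm⟩
    have : ds = fun _ => d := funext fun i => (Option.some.inj (h i)).symm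
    rwa [this] at hm
  · exact fun h => ⟨_, fun _ => rfl, h⟩

theorem extw_pSet {I : Interp Sig19} (hI : I.Valid) (w : W) :
    extw I w 1 0 (fun c i => .dom (c i)) (fun c => pForm (c 0)) =
      mkSet? { v | ∃ d, pAtom d ∈ I.atoms w ∧ v = (d, []) } := by
  have hdom : ∀ e, I.s w (.dom e) = some e := by
    cases w
    exacts [hI.1.1, hI.2.1.1]
  unfold extw
  rw [if_neg (by simp [hdom])]
  congr 1
  ext v
  simp only [satS_pForm hI, hdom, Set.mem_ofPred_eq]
  constructor
  · rintro ⟨c, ds, hc, hd, rfl⟩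
    refine ⟨c 0, hc, ?_⟩
    have : c 0 = ds 0 := Option.some.inj (hd 0)
    simp [famToTup, this]
  · rintro ⟨d, hd, rfl⟩
    exact ⟨fun _ => d, fun _ => d, hd, fun _ => rfl, by simp [famToTup]⟩

theorem satS_countGe_of_eq {I : Interp Sig19} (hI : I.Valid) (hA : ArithStd G19 I)
    (hagg : AggCoherent G19 I) {w : W} {d : D Sig19} (hd : I.s w pSet = some d)
    (hset : IsSetD d) {x : Tup (D Sig19)} (hx : ∀ v, dmem v d ↔ v = x) :
    SatS I w countGe := by
  have hdom : ∀ e, I.s w (.dom e) = some e := by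
    cases w
    exacts [hI.1.1, hI.2.1.1]
  have hmem : { v | dmem v d } = {x} := by
    ext v
    simp [hx]
  have hcount : I.s w countP = some (intD19 1) := by
    refine ((hagg.2 () trivial pSet).1 w d hd hset).trans ?_
    simp [G19, hmem, hset]
  refine ⟨fun _ => intD19 1, fun i => ?_, ?_⟩
  · have : ∀ j : Fin 2, I.s w (if j = 0 then countP else .dom (intD19 1)) =
        some (intD19 1) := by
      intro j
      split_ifs
      exacts [hcount, hdom _]
    exact this _
  · exact (hA .ge (fun _ => intD19 1) w).2 ⟨1, 1, rfl, rfl, le_refl (1 : ℤ)⟩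

theorem not_satS_countGe_of_none {I : Interp Sig19} (hI : I.Valid) {w : W}
    (h : I.s w pSet = none) : ¬ SatS I w countGe := by
  have hcount : I.s w countP = none := by
    cases w
    exacts [hI.1.2.2.2.2.1 () (fun _ => pSet) ⟨(0 : Fin 1), h⟩,
      hI.2.1.2.2.2.2.1 () (fun _ => pSet) ⟨(0 : Fin 1), h⟩]
  rintro ⟨ds, hds, -⟩
  have h0 : I.s w countP = some (ds (0 : Fin 2)) := hds (0 : Fin 2)
  simp [hcount] at h0

/-- The theory consisting of the fact `p(b)` and the rule
`count{X : p(X)} ≥ 1 → p(a)` has no stable model under the `SQHT⁼_𝒮`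
equilibrium semantics with interpretations coherent w.r.t. aggregates. -/
theorem no_stable_model_19 :
    ¬ ∃ T : Set (GAtom Sig19), StableAgg G19 {fact19, rule19} T := by
  rintro ⟨T, σ, ⟨hV, hagg, hA, hmod⟩, hmin⟩
  have hσ : AssignValid σ := hV.1
  have hfact : SatS (totalI σ T) .h (pForm bD) := hmod fact19 (by simp)
  have hb : pAtom bD ∈ T := (satS_pForm hV .h bD).1 hfact
  have hrule : SatS (totalI σ T) .h (.imp countGe (pForm aD)) := hmod rule19 (by simp)
  have hruleT := (satS_imp_here.1 hrule).2
  have hpT : σ pSet = mkSet? { v | ∃ d, pAtom d ∈ T ∧ v = (d, []) } :=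
    (extw_total_eq hagg.1 1 0 _ _).symm.trans (extw_pSet hV .t)
  obtain ⟨e, he⟩ := exists_mkSet?_singleton_atomD
    (HTerm.mk (Sum.inl AB.b) fun i => Fin.elim0 i : HTerm Sig19.C Sig19.arC)
  change mkSet? {(bD, [])} = some e at he
  obtain ⟨heset, hemem⟩ := mkSet?_spec he
  have hab : aD ≠ bD := fun h => by
    have h' := atomD_injective h
    injection h' with h1
    cases h1
  have hx : ∃ x, pAtom x ∈ T ∧ x ≠ bD := by
    by_contra! hno
    have hs : { v : Tup (D Sig19) | ∃ d, pAtom d ∈ T ∧ v = (d, []) } = {(bD, [])} := by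
      ext v
      constructor
      · rintro ⟨d, hd, rfl⟩
        rw [hno d hd]
        rfl
      · rintro rfl
        exact ⟨bD, hb, rfl⟩
    rw [hs, he] at hpT
    exact hab (hno aD ((satS_pForm hV .t aD).1
      (hruleT (satS_countGe_of_eq hV hA hagg (w := .t) hpT heset hemem))))
  obtain ⟨x, hxT, hxb⟩ := hx
  set H : Set (GAtom Sig19) := { g ∈ T | g.1 = P19.p → g = pAtom bD } with hH
  have hHT : H ⊂ T :=
    ⟨fun g hg => hg.1, fun h => hxb (pAtom_injective ((h hxT).2 rfl))⟩
  have hbH : pAtom bD ∈ H := ⟨hb, fun _ => rfl⟩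
  have hVI := shrinkHere_valid hσ hHT.subset
  have hundef : (shrinkHere σ T H).s .h pSet = none := by
    refine (hereVal_iset H 1 0 _ _).trans (if_neg fun h => ?_)
    have h1 := (extw_pSet hVI .h).symm.trans h
    have hs : { v : Tup (D Sig19) | ∃ d, pAtom d ∈ H ∧ v = (d, []) } = {(bD, [])} := by
      ext v
      constructor
      · rintro ⟨d, hd, rfl⟩
        rw [pAtom_injective (hd.2 rfl)]
        rfl
      · rintro rfl
        exact ⟨bD, hbH, rfl⟩
    change mkSet? { v : Tup (D Sig19) | ∃ d, pAtom d ∈ H ∧ v = (d, []) } = σ pSet at h1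
    rw [hs, he, hpT] at h1
    have hx := ((mkSet?_spec h1.symm).2 (x, [])).2 ⟨x, hxT, rfl⟩
    exact hxb (congrArg Prod.fst ((hemem _).1 hx))
  refine hmin _ (shrinkHere_lt hσ hHT) ⟨hVI, shrinkHere_aggCoherent H hσ hagg, ?_, ?_⟩
  · rintro o ds (_ | _)
    · refine Iff.trans ?_ (hA o ds .t)
      exact ⟨fun h => h.1, fun h => ⟨h, fun h' => by cases h'⟩⟩
    · exact hA o ds .t
  · rintro φ (rfl | rfl)
    · exact (satS_pForm hVI .h bD).2 hbH
    · refine satS_imp_here.2 ⟨fun h => absurd h (not_satS_countGe_of_none hVI hundef), ?_⟩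
      have ht := satS_there_congr (I := shrinkHere σ T H) (J := totalI σ T) rfl rfl
      intro h
      exact (ht _).2 (hruleT ((ht _).1 h))

end
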